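/- Let α ≥ 0 be a real number and let G be a simple graph on n vertices with matching number β. If n = ((2α+3)β + α + 2)/(α+1), then ρ_α(G) ≤ 2(α+1)β, with equality if and only if G is isomorphic to the join K_β ∨ K̄_{n−β} or to the disjoint union K_{2β+1} ∪ K̄_{n−2β−1}. -/

import Mathlib

open scoped Classical

/-- The adjacency matrix of a graph, over ℝ. -/
noncomputable def adjMat {V : Type*} [Fintype V] (G : SimpleGraph V) : Matrix V V ℝ :=
  fun i j => if G.Adj i j then 1 else 0

/-- The diagonal matrix of vertex degrees, over ℝ. -/
noncomputable def degMat {V : Type*} [Fintype V] (G : SimpleGraph V) : Matrix V V ℝ :=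
  fun i j => if i = j then ((G.neighborSet i).ncard : ℝ) else 0

/-- The largest (real) eigenvalue of a matrix. -/
noncomputable def specRad {V : Type*} [Fintype V] (M : Matrix V V ℝ) : ℝ :=
  sSup {t : ℝ | ∃ v : V → ℝ, v ≠ 0 ∧ M.mulVec v = t • v}

/-- The α-spectral radius: the largest eigenvalue of A_α(G) = α·D(G) + A(G). -/
noncomputable def alphaRadius {V : Type*} [Fintype V] (α : ℝ) (G : SimpleGraph V) : ℝ :=
  specRad (α • degMat G + adjMat G)

/-- The matching number of a graph. -/
noncomputable def matchingNumber {V : Type*} [Fintype V] (G : SimpleGraph V) : ℕ :=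
  sSup {m : ℕ | ∃ M : G.Subgraph, M.IsMatching ∧ M.edgeSet.ncard = m}

/-- The join of two graphs. -/
def graphJoin {A B : Type*} (G : SimpleGraph A) (H : SimpleGraph B) : SimpleGraph (A ⊕ B) :=
  SimpleGraph.fromRel (fun x y => match x, y with
    | Sum.inl a, Sum.inl b => G.Adj a b
    | Sum.inr a, Sum.inr b => H.Adj a b
    | _, _ => True)

/-- The disjoint union of two graphs. -/
def graphSum {A B : Type*} (G : SimpleGraph A) (H : SimpleGraph B) : SimpleGraph (A ⊕ B) :=
  SimpleGraph.fromRel (fun x y => match x, y with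
    | Sum.inl a, Sum.inl b => G.Adj a b
    | Sum.inr a, Sum.inr b => H.Adj a b
    | _, _ => False)

/-- The number of odd components of G − S. -/
noncomputable def oddComponentsOutside {V : Type*} [Fintype V] (G : SimpleGraph V) (S : Set V) : ℕ :=
  Set.ncard {c : (G.induce Sᶜ).ConnectedComponent | Odd c.supp.ncard}

/-- The disjoint union of cliques K_{f 0} ∪ ⋯ ∪ K_{f (q-1)}. -/
def cliquesUnion (q : ℕ) (f : Fin q → ℕ) : SimpleGraph (Σ i : Fin q, Fin (f i)) :=
  SimpleGraph.fromRel (fun x y => x.1 = y.1)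

open Finset

section Join

variable {A B : Type*} {G : SimpleGraph A} {H : SimpleGraph B}

@[simp] lemma graphJoin_adj_inl_inl {a b : A} :
    (graphJoin G H).Adj (Sum.inl a) (Sum.inl b) ↔ G.Adj a b := by
  simp only [graphJoin, SimpleGraph.fromRel_adj, ne_eq, Sum.inl.injEq, G.adj_comm b a, or_self]
  exact ⟨fun h => h.2, fun h => ⟨h.ne, h⟩⟩

@[simp] lemma graphJoin_adj_inr_inr {a b : B} :
    (graphJoin G H).Adj (Sum.inr a) (Sum.inr b) ↔ H.Adj a b := by
  simp only [graphJoin, SimpleGraph.fromRel_adj, ne_eq, Sum.inr.injEq, H.adj_comm b a, or_self]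
  exact ⟨fun h => h.2, fun h => ⟨h.ne, h⟩⟩

@[simp] lemma graphJoin_adj_inl_inr {a : A} {b : B} :
    (graphJoin G H).Adj (Sum.inl a) (Sum.inr b) := by
  simp [graphJoin]

@[simp] lemma graphJoin_adj_inr_inl {a : A} {b : B} :
    (graphJoin G H).Adj (Sum.inr b) (Sum.inl a) := by
  simp [graphJoin]

@[simp] lemma graphSum_adj_inl_inl {a b : A} :
    (graphSum G H).Adj (Sum.inl a) (Sum.inl b) ↔ G.Adj a b := by
  simp only [graphSum, SimpleGraph.fromRel_adj, ne_eq, Sum.inl.injEq, G.adj_comm b a, or_self]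
  exact ⟨fun h => h.2, fun h => ⟨h.ne, h⟩⟩

@[simp] lemma graphSum_adj_inr_inr {a b : B} :
    (graphSum G H).Adj (Sum.inr a) (Sum.inr b) ↔ H.Adj a b := by
  simp only [graphSum, SimpleGraph.fromRel_adj, ne_eq, Sum.inr.injEq, H.adj_comm b a, or_self]
  exact ⟨fun h => h.2, fun h => ⟨h.ne, h⟩⟩

@[simp] lemma graphSum_not_adj_inl_inr {a : A} {b : B} :
    ¬(graphSum G H).Adj (Sum.inl a) (Sum.inr b) := by
  simp [graphSum]

@[simp] lemma graphSum_not_adj_inr_inl {a : A} {b : B} :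
    ¬(graphSum G H).Adj (Sum.inr b) (Sum.inl a) := by
  simp [graphSum]

end Join

section Deficiency

variable {V : Type*} [Fintype V] {G : SimpleGraph V}

lemma ncard_edgeSet_le_matchingNumber {M : G.Subgraph} (hM : M.IsMatching) :
    M.edgeSet.ncard ≤ matchingNumber G := by
  refine le_csSup ⟨(Set.univ : Set (Sym2 V)).ncard, ?_⟩ ⟨M, hM, rfl⟩
  rintro m ⟨M', -, rfl⟩
  exact Set.ncard_le_ncard (Set.subset_univ _)

lemma SimpleGraph.Subgraph.IsMatching.ncard_verts {M : G.Subgraph} (hM : M.IsMatching) :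
    M.verts.ncard = 2 * M.edgeSet.ncard := by
  have h := M.spanningCoe.sum_degrees_eq_twice_card_edges
  have hE : #M.spanningCoe.edgeFinset = M.edgeSet.ncard := by
    rw [← SimpleGraph.Subgraph.edgeSet_spanningCoe, ← SimpleGraph.coe_edgeFinset,
      Set.ncard_coe_finset]
  rw [← hE, ← h, Set.ncard_eq_toFinset_card', Finset.card_eq_sum_ones,
    ← Finset.sum_subset (Finset.subset_univ M.verts.toFinset)]
  · refine Finset.sum_congr rfl fun v hv => ?_
    obtain ⟨w, hw, hu⟩ := hM (Set.mem_toFinset.1 hv)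
    symm
    rw [← SimpleGraph.card_neighborFinset_eq_degree, Finset.card_eq_one]
    exact ⟨w, by ext x; simpa using ⟨fun h => hu x h, fun h => h ▸ hw⟩⟩
  · intro v _ hv
    rw [← SimpleGraph.card_neighborFinset_eq_degree, Finset.card_eq_zero]
    ext x
    simpa using fun h => hv (Set.mem_toFinset.2 (M.edge_vert h))

lemma card_le_of_isPerfectMatching_graphJoin {k : ℕ}
    {M : (graphJoin G (⊤ : SimpleGraph (Fin k))).Subgraph} (hM : M.IsPerfectMatching) :
    Fintype.card V ≤ 2 * matchingNumber G + k := by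
  rw [SimpleGraph.Subgraph.isPerfectMatching_iff] at hM
  let N : G.Subgraph :=
    { verts := {a | ∃ b, M.Adj (Sum.inl a) (Sum.inl b)}
      Adj := fun a b => M.Adj (Sum.inl a) (Sum.inl b)
      adj_sub := fun h => graphJoin_adj_inl_inl.1 (M.adj_sub h)
      edge_vert := fun h => ⟨_, h⟩
      symm := ⟨fun _ _ h => h.symm⟩ }
  have hN : N.IsMatching := by
    rintro a ⟨b, hb⟩
    refine ⟨b, hb, fun c hc => ?_⟩
    exact Sum.inl_injective ((hM (Sum.inl a)).unique hc hb)
  have hpartner (a : (N.vertsᶜ : Set V)) : ∃ j : Fin k, M.Adj (Sum.inl a.1) (Sum.inr j) := by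
    obtain ⟨w | j, hw, -⟩ := hM (Sum.inl a.1)
    · exact absurd ⟨w, hw⟩ a.2
    · exact ⟨j, hw⟩
  choose f hf using hpartner
  have hinj : Function.Injective f := by
    intro a b hab
    have ha := (hf a).symm
    have hb := (hf b).symm
    rw [← hab] at hb
    exact Subtype.ext (Sum.inl_injective ((hM (Sum.inr (f a))).unique ha hb))
  have hc := Nat.card_le_card_of_injective f hinj
  rw [Nat.card_coe_set_eq, Nat.card_fin] at hc
  have h1 := Set.ncard_add_ncard_compl N.verts
  rw [Nat.card_eq_fintype_card] at h1
  have h2 := hN.ncard_verts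
  have h3 := ncard_edgeSet_le_matchingNumber hN
  omega

/-- The nontrivial half of the Tutte–Berge formula, with components of arbitrary parity. -/
lemma exists_le_card_connectedComponent {k : ℕ}
    (hk : Fintype.card V = 2 * matchingNumber G + 2 + k) :
    ∃ S : Set V, S.ncard + k + 2 ≤ Nat.card (G.induce Sᶜ).ConnectedComponent := by
  have hno : ¬ ∃ M : (graphJoin G (⊤ : SimpleGraph (Fin k))).Subgraph, M.IsPerfectMatching := by
    rintro ⟨M, hM⟩
    have := card_le_of_isPerfectMatching_graphJoin hM
    omega
  rw [SimpleGraph.tutte] at hno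
  push Not at hno
  obtain ⟨u, hu⟩ := hno
  rw [SimpleGraph.IsTutteViolator] at hu
  set K := ((⊤ : (graphJoin G (⊤ : SimpleGraph (Fin k))).Subgraph).deleteVerts u) with hK
  have hmem (x) : x ∈ K.verts ↔ x ∉ u := by simp [hK]
  have hadj {x y : K.verts} : K.coe.Adj x y ↔
      (graphJoin G (⊤ : SimpleGraph (Fin k))).Adj x.1 y.1 := by
    have hx := (hmem _).1 x.2
    have hy := (hmem _).1 y.2
    simp [hK, hx, hy]
  have hparity := K.coe.odd_ncard_oddComponents
  have hcard : Nat.card K.verts + u.ncard = 2 * (matchingNumber G + 1 + k) := by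
    have hv : K.verts = uᶜ := by ext x; simp [hmem]
    rw [hv, Nat.card_coe_set_eq, add_comm, Set.ncard_add_ncard_compl, Nat.card_eq_fintype_card,
      Fintype.card_sum, Fintype.card_fin]
    omega
  by_cases hall : ∀ j : Fin k, Sum.inr j ∈ u
  · refine ⟨Sum.inl ⁻¹' u, ?_⟩
    have hucard : u.ncard = (Sum.inl ⁻¹' u : Set V).ncard + k := by
      have : u = Sum.inl '' (Sum.inl ⁻¹' u : Set V) ∪ Set.range Sum.inr := by
        ext (x | j)
        · simp
        · simp [hall]
      conv_lhs => rw [this]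
      rw [Set.ncard_union_eq, Set.ncard_image_of_injective _ Sum.inl_injective,
        ← Set.image_univ, Set.ncard_image_of_injective _ Sum.inr_injective, Set.ncard_univ,
        Nat.card_fin]
      rw [Set.disjoint_left]
      rintro _ ⟨a, -, rfl⟩ ⟨b, hb⟩
      simp at hb
    let φ : G.induce (Sum.inl ⁻¹' u : Set V)ᶜ →g K.coe :=
      { toFun := fun x => ⟨Sum.inl x.1, (hmem _).2 x.2⟩
        map_rel' := fun {x y} h => hadj.2 (graphJoin_adj_inl_inl.2 h) }
    have hsurj : Function.Surjective
        (SimpleGraph.ConnectedComponent.map φ) := by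
      intro c
      induction c using SimpleGraph.ConnectedComponent.ind with
      | _ v =>
        obtain ⟨x | j, hv⟩ := v
        · exact ⟨SimpleGraph.connectedComponentMk _ ⟨x, (hmem _).1 hv⟩, rfl⟩
        · exact absurd (hall j) ((hmem _).1 hv)
    have h1 := Nat.card_le_card_of_surjective _ hsurj
    have h2 : K.coe.oddComponents.ncard ≤ Nat.card K.coe.ConnectedComponent := by
      rw [← Set.ncard_univ]
      exact Set.ncard_le_ncard (Set.subset_univ _)
    rw [Nat.odd_iff, Nat.odd_iff] at hparity
    omega
  · push Not at hall
    obtain ⟨j, hj⟩ := hall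
    have hone : K.coe.oddComponents.ncard ≤ 1 := by
      refine (Set.ncard_le_one_iff (Set.toFinite _)).2 fun {a b} _ _ => ?_
      suffices h : ∀ c : K.coe.ConnectedComponent,
          c = K.coe.connectedComponentMk ⟨Sum.inr j, (hmem _).2 hj⟩ from (h a).trans (h b).symm
      intro c
      induction c using SimpleGraph.ConnectedComponent.ind with
      | _ v =>
        by_cases hv : v = ⟨Sum.inr j, (hmem _).2 hj⟩
        · rw [hv]
        · refine SimpleGraph.ConnectedComponent.sound (SimpleGraph.Adj.reachable (hadj.2 ?_))
          obtain ⟨x | i, hx⟩ := v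
          · simp
          · simpa using hv
    rw [Nat.odd_iff, Nat.odd_iff] at hparity
    omega

end Deficiency

section Components

lemma card_connectedComponent_add_degree_le {W : Type*} [Fintype W] (H : SimpleGraph W)
    [DecidableRel H.Adj] (i : W) :
    Nat.card H.ConnectedComponent + #{j | H.Adj i j} ≤ Fintype.card W ∧
      (Nat.card H.ConnectedComponent + #{j | H.Adj i j} = Fintype.card W →
        ∀ a b, ¬H.Adj i a → ¬H.Adj i b → H.Reachable a b → a = b) := by
  have himage : (univ.filter fun j => ¬H.Adj i j).image H.connectedComponentMk = univ := by
    refine eq_univ_of_forall fun c => ?_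
    induction c using SimpleGraph.ConnectedComponent.ind with
    | _ v =>
      by_cases hv : H.Adj i v
      · exact mem_image.2 ⟨i, by simp, SimpleGraph.ConnectedComponent.sound hv.reachable⟩
      · exact mem_image.2 ⟨v, by simpa using hv, rfl⟩
  have hcard : Nat.card H.ConnectedComponent =
      #((univ.filter fun j => ¬H.Adj i j).image H.connectedComponentMk) := by
    rw [himage, Nat.card_eq_fintype_card, card_univ]
  have hle := card_image_le (s := univ.filter fun j => ¬H.Adj i j) (f := H.connectedComponentMk)
  have hsplit := card_filter_add_card_filter_not (s := univ) (fun j => H.Adj i j)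
  rw [card_univ] at hsplit
  refine ⟨by omega, fun heq a b ha hb hab => ?_⟩
  have hinj := card_image_iff.1 (le_antisymm hle (by omega))
  exact hinj (by simpa using ha) (by simpa using hb) (SimpleGraph.ConnectedComponent.sound hab)

/-- A barrier set for the matching number: the consequences of the Tutte–Berge formula for the
degrees in the graph with the barrier removed. -/
lemma exists_barrier {V : Type*} [Fintype V] {G : SimpleGraph V} {k : ℕ}
    (hk : Fintype.card V = 2 * matchingNumber G + 2 + k) :
    ∃ S : Finset V, #S ≤ matchingNumber G ∧
      (∀ i ∉ S, #{j | G.Adj i j ∧ j ∉ S} + 2 * #S ≤ 2 * matchingNumber G) ∧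
      (S = ∅ → ∀ i, #{j | G.Adj i j} = 2 * matchingNumber G →
        ∀ a b, ¬G.Adj i a → ¬G.Adj i b → G.Reachable a b → a = b) := by
  obtain ⟨S, hS⟩ := exists_le_card_connectedComponent hk
  have hScard : #S.toFinset = S.ncard := (Set.ncard_eq_toFinset_card' S).symm
  have hW : Fintype.card (Sᶜ : Set V) + S.ncard = Fintype.card V := by
    rw [← Nat.card_eq_fintype_card, Nat.card_coe_set_eq, add_comm, Set.ncard_add_ncard_compl,
      Nat.card_eq_fintype_card]
  have hcomp : Nat.card (G.induce Sᶜ).ConnectedComponent ≤ Fintype.card (Sᶜ : Set V) := by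
    rw [← Nat.card_eq_fintype_card]
    exact Nat.card_le_card_of_surjective (G.induce Sᶜ).connectedComponentMk Quot.mk_surjective
  have hdeg (i : (Sᶜ : Set V)) :
      #{j | (G.induce Sᶜ).Adj i j} = #{j | G.Adj i j ∧ j ∉ S.toFinset} := by
    rw [← card_map (Function.Embedding.subtype _)]
    congr 1
    ext x
    simp [and_comm]
  refine ⟨S.toFinset, by omega, fun i hi => ?_, fun hempty i hi a b ha hb hab => ?_⟩
  · have h := (card_connectedComponent_add_degree_le (G.induce Sᶜ) ⟨i, by simpa using hi⟩).1
    rw [hdeg] at h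
    dsimp only at h
    omega
  · have hall (x : V) : x ∈ Sᶜ := fun hx => by simpa [hempty] using Set.mem_toFinset.2 hx
    have h := card_connectedComponent_add_degree_le (G.induce Sᶜ) ⟨i, hall i⟩
    rw [hdeg] at h
    simp only [hempty, notMem_empty, not_false_eq_true, and_true, hi] at h
    rw [hempty, card_empty] at hScard
    let φ : G →g G.induce Sᶜ := ⟨fun x => ⟨x, hall x⟩, fun h => h⟩
    exact congrArg Subtype.val (h.2 (by omega) (φ a) (φ b) ha hb (hab.map φ))

end Components

section Iso

lemma exists_equiv_sum {n a : ℕ} {S : Finset (Fin n)} (hS : #S = a) :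
    ∃ e : Fin n ≃ Fin a ⊕ Fin (n - a), ∀ i, (e i).isLeft ↔ i ∈ S := by
  have h1 : Fintype.card {i // i ∈ S} = a := by simpa using hS
  have h2 : Fintype.card {i // i ∉ S} = n - a := by
    rw [Fintype.card_subtype_compl, h1, Fintype.card_fin]
  refine ⟨(Equiv.sumCompl (· ∈ S)).symm.trans
    (Equiv.sumCongr (Fintype.equivFinOfCardEq h1) (Fintype.equivFinOfCardEq h2)), fun i => ?_⟩
  by_cases hi : i ∈ S <;> simp [hi]

lemma nonempty_iso_sum_iff {n a : ℕ} {G : SimpleGraph (Fin n)}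
    {H : SimpleGraph (Fin a ⊕ Fin (n - a))} {P : Prop → Prop → Prop}
    (hH : ∀ x y, H.Adj x y ↔ x ≠ y ∧ P (x.isLeft) (y.isLeft)) :
    Nonempty (G ≃g H) ↔
      ∃ S : Finset (Fin n), #S = a ∧ ∀ i j, G.Adj i j ↔ i ≠ j ∧ P (i ∈ S) (j ∈ S) := by
  constructor
  · rintro ⟨e⟩
    refine ⟨(univ : Finset (Fin a)).map (Function.Embedding.inl.trans e.symm.toEquiv.toEmbedding),
      by simp, fun i j => ?_⟩
    have hmem (i : Fin n) : (i ∈ (univ : Finset (Fin a)).map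
        (Function.Embedding.inl.trans e.symm.toEquiv.toEmbedding)) = ((e i).isLeft : Prop) := by
      simp only [mem_map, mem_univ, true_and, eq_iff_iff, Sum.isLeft_iff]
      refine exists_congr fun x => ?_
      change e.symm (Sum.inl x) = i ↔ _
      rw [e.symm_apply_eq, eq_comm]
    rw [hmem, hmem, ← e.map_adj_iff, hH, e.injective.ne_iff]
  · rintro ⟨S, hS, hG⟩
    obtain ⟨e, he⟩ := exists_equiv_sum hS
    refine ⟨⟨e, fun {i j} => ?_⟩⟩
    rw [hH, hG, e.injective.ne_iff, propext (he i), propext (he j)]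

lemma nonempty_iso_graphJoin_iff {n a : ℕ} {G : SimpleGraph (Fin n)} :
    Nonempty (G ≃g graphJoin (⊤ : SimpleGraph (Fin a)) (⊥ : SimpleGraph (Fin (n - a)))) ↔
      ∃ S : Finset (Fin n), #S = a ∧ ∀ i j, G.Adj i j ↔ i ≠ j ∧ (i ∈ S ∨ j ∈ S) :=
  nonempty_iso_sum_iff (P := Or) (by rintro (x | x) (y | y) <;> simp)

lemma nonempty_iso_graphSum_iff {n a : ℕ} {G : SimpleGraph (Fin n)} :
    Nonempty (G ≃g graphSum (⊤ : SimpleGraph (Fin a)) (⊥ : SimpleGraph (Fin (n - a)))) ↔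
      ∃ S : Finset (Fin n), #S = a ∧ ∀ i j, G.Adj i j ↔ i ≠ j ∧ (i ∈ S ∧ j ∈ S) :=
  nonempty_iso_sum_iff (P := And) (by rintro (x | x) (y | y) <;> simp)

end Iso

section Spectral

variable {V : Type*} [Fintype V]

/-- A Collatz–Wielandt bound, with its equality case. -/
lemma eigenvalue_le_of_mulVec_le {M : Matrix V V ℝ} (hsymm : M.IsSymm) (hM : ∀ i j, 0 ≤ M i j)
    {x : V → ℝ} (hx : ∀ i, 0 < x i) {μ : ℝ} (hμ : ∀ i, M.mulVec x i ≤ μ * x i)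
    {t : ℝ} {v : V → ℝ} (hv : v ≠ 0) (hvt : M.mulVec v = t • v) :
    t ≤ μ ∧ (t = μ → ∃ w : V → ℝ, (∀ i, 0 ≤ w i) ∧ w ≠ 0 ∧ (∀ i, M.mulVec w i = μ * w i) ∧
      ∀ i, w i ≠ 0 → M.mulVec x i = μ * x i) := by
  set w : V → ℝ := fun i => |v i| with hw
  have hw0 (i) : 0 ≤ w i := abs_nonneg _
  have hwv (i) : t * w i ≤ M.mulVec w i := by
    calc t * w i ≤ |t * v i| := by rw [abs_mul]; gcongr; exact le_abs_self t
      _ = |M.mulVec v i| := by rw [hvt]; rfl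
      _ ≤ ∑ j, |M i j * v j| := abs_sum_le_sum_abs _ _
      _ = M.mulVec w i := by simp [Matrix.mulVec, dotProduct, abs_mul, abs_of_nonneg (hM _ _), hw]
  have hadjoint : ∑ i, x i * M.mulVec w i = ∑ i, M.mulVec x i * w i := by
    change x ⬝ᵥ M.mulVec w = M.mulVec x ⬝ᵥ w
    rw [Matrix.dotProduct_mulVec, ← Matrix.mulVec_transpose, hsymm]
  have h1 : ∑ i, x i * (t * w i) ≤ ∑ i, x i * M.mulVec w i :=
    sum_le_sum fun i _ => mul_le_mul_of_nonneg_left (hwv i) (hx i).le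
  have h2 : ∑ i, M.mulVec x i * w i ≤ ∑ i, μ * x i * w i :=
    sum_le_sum fun i _ => mul_le_mul_of_nonneg_right (hμ i) (hw0 i)
  have h3 : ∑ i, x i * (t * w i) = t * ∑ i, x i * w i := by
    rw [mul_sum]; exact sum_congr rfl fun i _ => by ring
  have h4 : ∑ i, μ * x i * w i = μ * ∑ i, x i * w i := by
    rw [mul_sum]; exact sum_congr rfl fun i _ => by ring
  obtain ⟨i₀, hi₀⟩ := Function.ne_iff.1 hv
  have hpos : 0 < ∑ i, x i * w i :=
    sum_pos' (fun i _ => mul_nonneg (hx i).le (hw0 i))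
      ⟨i₀, mem_univ _, mul_pos (hx _) (abs_pos.2 hi₀)⟩
  refine ⟨le_of_mul_le_mul_right (by linarith) hpos, ?_⟩
  rintro rfl
  refine ⟨w, hw0, fun h => hi₀ (abs_eq_zero.1 (congrFun h i₀)), fun i => ?_, fun i hi => ?_⟩
  · have h := (sum_eq_sum_iff_of_le fun i _ =>
      mul_le_mul_of_nonneg_left (hwv i) (hx i).le).1 (by linarith) i (mem_univ i)
    exact (mul_left_cancel₀ (hx i).ne' h).symm
  · have h := (sum_eq_sum_iff_of_le fun i _ =>
      mul_le_mul_of_nonneg_right (hμ i) (hw0 i)).1 (by linarith) i (mem_univ i)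
    exact mul_right_cancel₀ hi h

lemma specRad_mem {M : Matrix V V ℝ} (hM : 0 < specRad M) :
    ∃ v : V → ℝ, v ≠ 0 ∧ M.mulVec v = specRad M • v := by
  have hne : {t : ℝ | ∃ v : V → ℝ, v ≠ 0 ∧ M.mulVec v = t • v}.Nonempty := by
    rw [Set.nonempty_iff_ne_empty]
    intro h
    rw [specRad, h, Real.sSup_empty] at hM
    exact hM.false
  refine hne.csSup_mem ((Module.End.finite_hasEigenvalue (Matrix.toLin' M)).subset ?_)
  rintro t ⟨v, hv, hvt⟩
  exact Module.End.hasEigenvalue_of_hasEigenvector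
    ⟨Module.End.mem_eigenspace_iff.2 (by simpa using hvt), hv⟩

lemma specRad_eq_of_mulVec_eq {M : Matrix V V ℝ} {μ : ℝ}
    (hM : ∀ (t : ℝ) (v : V → ℝ), v ≠ 0 → M.mulVec v = t • v → t ≤ μ)
    {x : V → ℝ} (hx : x ≠ 0) (hxμ : M.mulVec x = μ • x) : specRad M = μ :=
  IsGreatest.csSup_eq ⟨⟨x, hx, hxμ⟩, fun t ⟨v, hv, hvt⟩ => hM t v hv hvt⟩

lemma mulVec_alpha_apply (α : ℝ) (G : SimpleGraph V) (x : V → ℝ) (i : V) :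
    (α • degMat G + adjMat G).mulVec x i =
      α * #{j | G.Adj i j} * x i + ∑ j with G.Adj i j, x j := by
  have hdeg : (G.neighborSet i).ncard = #{j | G.Adj i j} := by
    rw [← Set.ncard_coe_finset]; congr 1; ext; simp
  rw [Matrix.add_mulVec, Matrix.smul_mulVec]
  simp [Matrix.mulVec, dotProduct, degMat, adjMat, hdeg, sum_filter, mul_assoc]

lemma isSymm_alpha (α : ℝ) (G : SimpleGraph V) : (α • degMat G + adjMat G).IsSymm := by
  ext i j
  by_cases h : i = j
  · simp [h]
  · simp [degMat, adjMat, h, Ne.symm h, G.adj_comm]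

lemma alpha_nonneg {α : ℝ} (hα : 0 ≤ α) (G : SimpleGraph V) (i j : V) :
    0 ≤ (α • degMat G + adjMat G) i j := by
  simp only [Matrix.add_apply, Matrix.smul_apply, smul_eq_mul, degMat, adjMat]
  positivity

lemma eq_zero_of_mulVec_alpha {α μ : ℝ} {G : SimpleGraph V} {w : V → ℝ} (hw : ∀ i, 0 ≤ w i)
    {i j : V} (hj : (α • degMat G + adjMat G).mulVec w j = μ * w j) (hij : G.Adj i j)
    (hwj : w j = 0) : w i = 0 := by
  rw [mulVec_alpha_apply, hwj, mul_zero, mul_zero, zero_add,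
    sum_eq_zero_iff_of_nonneg fun i _ => hw i] at hj
  exact hj i (by simpa using hij.symm)

/-- The test vector of a vertex set `S`: it is `α + 2` on `S` and `1` elsewhere. -/
noncomputable def testVector (α : ℝ) (S : Finset V) (i : V) : ℝ := if i ∈ S then α + 2 else 1

omit [Fintype V] in
lemma testVector_pos {α : ℝ} (hα : 0 ≤ α) (S : Finset V) (i : V) : 0 < testVector α S i := by
  rw [testVector]
  split_ifs <;> linarith

lemma card_adj_split (G : SimpleGraph V) (S : Finset V) (i : V) :
    #{j | G.Adj i j} = #{j | G.Adj i j ∧ j ∈ S} + #{j | G.Adj i j ∧ j ∉ S} := by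
  rw [← card_filter_add_card_filter_not (fun j => j ∈ S), filter_filter, filter_filter]

lemma mulVec_testVector (α : ℝ) (G : SimpleGraph V) (S : Finset V) (i : V) :
    (α • degMat G + adjMat G).mulVec (testVector α S) i =
      α * (#{j | G.Adj i j ∧ j ∈ S} + #{j | G.Adj i j ∧ j ∉ S}) * testVector α S i +
        (#{j | G.Adj i j ∧ j ∈ S} * (α + 2) + #{j | G.Adj i j ∧ j ∉ S}) := by
  rw [mulVec_alpha_apply, card_adj_split G S, Nat.cast_add]
  congr 1
  simp only [testVector, sum_ite, filter_filter, sum_const, nsmul_eq_mul, mul_one]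

lemma card_adj_mem_le (G : SimpleGraph V) (S : Finset V) (i : V) :
    #{j | G.Adj i j ∧ j ∈ S} ≤ #S :=
  card_le_card fun _ hj => (mem_filter.1 hj).2.2

lemma card_adj_mem_lt (G : SimpleGraph V) {S : Finset V} {i : V} (hi : i ∈ S) :
    #{j | G.Adj i j ∧ j ∈ S} + 1 ≤ #S := by
  refine card_lt_card ⟨fun j hj => (mem_filter.1 hj).2.2, fun h => ?_⟩
  simpa using h hi

lemma card_adj_notMem_le (G : SimpleGraph V) (S : Finset V) (i : V) :
    #{j | G.Adj i j ∧ j ∉ S} + #S ≤ Fintype.card V := by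
  rw [← card_compl_add_card S]
  gcongr
  exact fun j hj => mem_compl.2 (mem_filter.1 hj).2.2

variable {α : ℝ} {β : ℕ} {G : SimpleGraph V} {S : Finset V}

lemma mulVec_testVector_of_notMem (hα : 0 ≤ α) {i : V} (hi : i ∉ S)
    (hdeg : #{j | G.Adj i j ∧ j ∉ S} + 2 * #S ≤ 2 * β) :
    (α • degMat G + adjMat G).mulVec (testVector α S) i ≤
        2 * (α + 1) * β * testVector α S i ∧
      ((α • degMat G + adjMat G).mulVec (testVector α S) i =
          2 * (α + 1) * β * testVector α S i ↔
        #{j | G.Adj i j ∧ j ∈ S} = #S ∧ #{j | G.Adj i j ∧ j ∉ S} + 2 * #S = 2 * β) := by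
  have hp := card_adj_mem_le G S i
  rw [mulVec_testVector, testVector, if_neg hi]
  generalize #{j | G.Adj i j ∧ j ∈ S} = p at *
  generalize #{j | G.Adj i j ∧ j ∉ S} = r at *
  generalize #S = s at *
  have key : 2 * (α + 1) * β * 1 - (α * (p + r) * 1 + (p * (α + 2) + r)) =
      (α + 1) * (((2 * β - (r + 2 * s) : ℝ)) + 2 * (s - p)) := by ring
  have hp' : (p : ℝ) ≤ s := by exact_mod_cast hp
  have hdeg' : (r : ℝ) + 2 * s ≤ 2 * β := by exact_mod_cast hdeg
  constructor
  · rw [← sub_nonneg, key]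
    exact mul_nonneg (by linarith) (by linarith)
  · rw [eq_comm, ← sub_eq_zero, key, mul_eq_zero, or_iff_right (by linarith)]
    constructor
    · intro h
      exact ⟨by exact_mod_cast (by linarith : (p : ℝ) = s),
        by exact_mod_cast (by linarith : (r : ℝ) + 2 * s = 2 * β)⟩
    · rintro ⟨rfl, h⟩
      have : (r : ℝ) + 2 * p = 2 * β := by exact_mod_cast h
      linarith

lemma mulVec_testVector_of_mem (hα : 0 ≤ α) {i : V} (hi : i ∈ S) (hS : #S ≤ β)
    (hcard : (α + 1) * Fintype.card V = (2 * α + 3) * β + α + 2) :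
    (α • degMat G + adjMat G).mulVec (testVector α S) i ≤
        2 * (α + 1) * β * testVector α S i ∧
      ((α • degMat G + adjMat G).mulVec (testVector α S) i =
          2 * (α + 1) * β * testVector α S i ↔
        #{j | G.Adj i j ∧ j ∈ S} + 1 = #S ∧
          #{j | G.Adj i j ∧ j ∉ S} + #S = Fintype.card V ∧ #S = β) := by
  have hp := card_adj_mem_lt G hi
  have hr := card_adj_notMem_le G S i
  rw [mulVec_testVector, testVector, if_pos hi]
  generalize #{j | G.Adj i j ∧ j ∈ S} = p at *
  generalize #{j | G.Adj i j ∧ j ∉ S} = r at *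
  generalize #S = s at *
  generalize Fintype.card V = n at *
  have key : 2 * (α + 1) * β * (α + 2) - (α * (p + r) * (α + 2) + (p * (α + 2) + r)) =
      (α + 1) * ((α + 2) * (s - (p + 1)) + (α + 1) * (n - (r + s)) + (β - s)) := by
    linear_combination (-(α + 1)) * hcard
  have hp' : (p : ℝ) + 1 ≤ s := by exact_mod_cast hp
  have hr' : (r : ℝ) + s ≤ n := by exact_mod_cast hr
  have hS' : (s : ℝ) ≤ β := by exact_mod_cast hS
  have h1 : 0 ≤ (α + 2) * ((s : ℝ) - (p + 1)) := mul_nonneg (by linarith) (by linarith)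
  have h2 : 0 ≤ (α + 1) * ((n : ℝ) - (r + s)) := mul_nonneg (by linarith) (by linarith)
  constructor
  · rw [← sub_nonneg, key]
    exact mul_nonneg (by linarith) (by linarith)
  · rw [eq_comm, ← sub_eq_zero, key, mul_eq_zero, or_iff_right (by linarith)]
    constructor
    · intro h
      have h1' : (α + 2) * ((s : ℝ) - (p + 1)) = 0 := by linarith
      have h2' : (α + 1) * ((n : ℝ) - (r + s)) = 0 := by linarith
      rw [mul_eq_zero, or_iff_right (by linarith)] at h1' h2'
      exact ⟨by exact_mod_cast (by linarith : (p : ℝ) + 1 = s),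
        by exact_mod_cast (by linarith : (r : ℝ) + s = n),
        by exact_mod_cast (by linarith : (s : ℝ) = β)⟩
    · rintro ⟨rfl, rfl, rfl⟩
      push_cast
      ring

end Spectral

section Extremal

variable {V : Type*} [Fintype V] {α : ℝ} {β : ℕ} {G : SimpleGraph V} {S : Finset V}

lemma card_adj_mem_eq_iff {i : V} : #{j | G.Adj i j ∧ j ∈ S} = #S ↔ ∀ j ∈ S, G.Adj i j := by
  constructor
  · intro h j hj
    rw [← eq_of_subset_of_card_le (fun j hj => (mem_filter.1 hj).2.2) h.ge] at hj
    exact (mem_filter.1 hj).2.1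
  · intro h
    congr 1
    ext j
    simpa using h j

lemma card_adj_mem_add_one_of_forall {i : V} (hi : i ∈ S) (h : ∀ j ∈ S, i ≠ j → G.Adj i j) :
    #{j | G.Adj i j ∧ j ∈ S} + 1 = #S := by
  rw [← card_erase_add_one hi]
  congr 2
  ext j
  simp only [mem_filter, mem_univ, true_and, mem_erase]
  exact ⟨fun hj => ⟨hj.1.ne', hj.2⟩, fun hj => ⟨h j hj.2 hj.1.symm, hj.2⟩⟩

lemma forall_adj_of_card {i : V} (h : #{j | G.Adj i j} + 1 = Fintype.card V) (j : V)
    (hij : i ≠ j) : G.Adj i j := by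
  have h1 : (univ.filter fun j => G.Adj i j) ⊆ univ.erase i := fun j hj => by
    simpa using (mem_filter.1 hj).2.ne'
  have h2 := eq_of_subset_of_card_le h1 (by rw [card_erase_of_mem (mem_univ i), card_univ]; omega)
  have h3 : j ∈ univ.filter fun j => G.Adj i j := by simpa [h2] using hij.symm
  exact (mem_filter.1 h3).2

lemma mulVec_testVector_le (hα : 0 ≤ α) (hS : #S ≤ β)
    (hdeg : ∀ i ∉ S, #{j | G.Adj i j ∧ j ∉ S} + 2 * #S ≤ 2 * β)
    (hcard : (α + 1) * Fintype.card V = (2 * α + 3) * β + α + 2) (i : V) :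
    (α • degMat G + adjMat G).mulVec (testVector α S) i ≤ 2 * (α + 1) * β * testVector α S i := by
  by_cases hi : i ∈ S
  · exact (mulVec_testVector_of_mem hα hi hS hcard).1
  · exact (mulVec_testVector_of_notMem hα hi (hdeg i hi)).1

lemma mulVec_testVector_of_join (hα : 0 ≤ α) (hS : #S = β)
    (hcard : (α + 1) * Fintype.card V = (2 * α + 3) * β + α + 2)
    (hG : ∀ i j, G.Adj i j ↔ i ≠ j ∧ (i ∈ S ∨ j ∈ S)) :
    (α • degMat G + adjMat G).mulVec (testVector α S) = (2 * (α + 1) * β) • testVector α S := by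
  ext i
  by_cases hi : i ∈ S
  · refine (mulVec_testVector_of_mem hα hi hS.le hcard).2.2 ⟨?_, ?_, hS⟩
    · exact card_adj_mem_add_one_of_forall hi fun j _ hij => (hG i j).2 ⟨hij, Or.inl hi⟩
    · rw [← card_compl_add_card S]
      congr 2
      ext j
      simp only [mem_filter, mem_univ, true_and, mem_compl, and_iff_right_iff_imp]
      exact fun hj => (hG i j).2 ⟨fun h => hj (h ▸ hi), Or.inl hi⟩
  · have h0 : #{j | G.Adj i j ∧ j ∉ S} = 0 := by
      rw [card_eq_zero, filter_eq_empty_iff]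
      rintro j - ⟨hij, hj⟩
      exact (((hG i j).1 hij).2.elim hi hj)
    refine (mulVec_testVector_of_notMem hα hi (by omega)).2.2 ⟨?_, by omega⟩
    exact card_adj_mem_eq_iff.2 fun j hj => (hG i j).2 ⟨fun h => hi (h ▸ hj), Or.inr hj⟩

lemma mulVec_indicator_of_clique (hS : #S = 2 * β + 1)
    (hG : ∀ i j, G.Adj i j ↔ i ≠ j ∧ (i ∈ S ∧ j ∈ S)) :
    (α • degMat G + adjMat G).mulVec (fun i => if i ∈ S then 1 else 0) =
      (2 * (α + 1) * β) • fun i => if i ∈ S then (1 : ℝ) else 0 := by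
  ext i
  rw [mulVec_alpha_apply, Pi.smul_apply, smul_eq_mul]
  by_cases hi : i ∈ S
  · have hN : (univ.filter fun j => G.Adj i j) = S.erase i := by
      ext j
      simp [hG, hi, eq_comm]
    have hsum : ∑ j ∈ S.erase i, (if j ∈ S then (1 : ℝ) else 0) = #(S.erase i) := by
      rw [sum_congr rfl fun j hj => if_pos (mem_of_mem_erase hj)]
      simp
    have herase : #(S.erase i) = 2 * β := by rw [card_erase_of_mem hi]; omega
    rw [hN, hsum, herase, if_pos hi]
    push_cast
    ring
  · have hN : (univ.filter fun j => G.Adj i j) = ∅ := by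
      ext j
      simp [hG, hi]
    simp [hN, hi]

/-- The equality case when the barrier is nonempty. -/
lemma adj_iff_of_eigenvector_of_nonempty (hα : 0 ≤ α) (hS : #S ≤ β) (hSne : S.Nonempty)
    (hdeg : ∀ i ∉ S, #{j | G.Adj i j ∧ j ∉ S} + 2 * #S ≤ 2 * β)
    (hcard : (α + 1) * Fintype.card V = (2 * α + 3) * β + α + 2)
    {w : V → ℝ} (hw : ∀ i, 0 ≤ w i) (hw0 : w ≠ 0)
    (hwμ : ∀ i, (α • degMat G + adjMat G).mulVec w i = 2 * (α + 1) * β * w i)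
    (hsupp : ∀ i, w i ≠ 0 → (α • degMat G + adjMat G).mulVec (testVector α S) i =
      2 * (α + 1) * β * testVector α S i) :
    #S = β ∧ ∀ i j, G.Adj i j ↔ i ≠ j ∧ (i ∈ S ∨ j ∈ S) := by
  have hclosed {i j : V} (hij : G.Adj i j) (hi : w i ≠ 0) : w j ≠ 0 := fun hj =>
    hi (eq_zero_of_mulVec_alpha hw (hwμ j) hij hj)
  have hmem {i : V} (hi : w i ≠ 0) (hiS : i ∈ S) :
      #S = β ∧ ∀ j, i ≠ j → G.Adj i j := by
    obtain ⟨hp, hr, hβ⟩ := (mulVec_testVector_of_mem hα hiS hS hcard).2.1 (hsupp i hi)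
    refine ⟨hβ, forall_adj_of_card ?_⟩
    have := card_adj_split G S i
    omega
  obtain ⟨i₀, hi₀⟩ := Function.ne_iff.1 hw0
  obtain ⟨s, hsS, hs⟩ : ∃ s ∈ S, w s ≠ 0 := by
    by_cases hiS : i₀ ∈ S
    · exact ⟨i₀, hiS, hi₀⟩
    · obtain ⟨s, hs⟩ := hSne
      have h := ((mulVec_testVector_of_notMem hα hiS (hdeg _ hiS)).2.1 (hsupp _ hi₀)).1
      exact ⟨s, hs, hclosed (card_adj_mem_eq_iff.1 h s hs) hi₀⟩
  have hall (i : V) : w i ≠ 0 := by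
    by_cases h : s = i
    · exact h ▸ hs
    · exact hclosed ((hmem hs hsS).2 i h) hs
  have hSβ := (hmem hs hsS).1
  refine ⟨hSβ, fun i j => ⟨fun hij => ⟨hij.ne, ?_⟩, ?_⟩⟩
  · by_contra! h
    have h0 : #{j | G.Adj i j ∧ j ∉ S} = 0 := by
      have := hdeg i h.1
      omega
    exact filter_eq_empty_iff.1 (card_eq_zero.1 h0) (mem_univ j) ⟨hij, h.2⟩
  · rintro ⟨hij, hi | hj⟩
    · exact (hmem (hall i) hi).2 j hij
    · exact ((hmem (hall j) hj).2 i hij.symm).symm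

/-- The equality case when the barrier is empty. -/
lemma adj_iff_of_eigenvector_of_regular {d : ℕ}
    (hcomp : ∀ i, #{j | G.Adj i j} = d → ∀ a b, ¬G.Adj i a → ¬G.Adj i b → G.Reachable a b → a = b)
    {w : V → ℝ} {μ : ℝ} (hw : ∀ i, 0 ≤ w i) (hw0 : w ≠ 0)
    (hwμ : ∀ i, (α • degMat G + adjMat G).mulVec w i = μ * w i)
    (hsupp : ∀ i, w i ≠ 0 → #{j | G.Adj i j} = d) :
    ∃ C : Finset V, #C = d + 1 ∧ ∀ i j, G.Adj i j ↔ i ≠ j ∧ (i ∈ C ∧ j ∈ C) := by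
  obtain ⟨i, hi⟩ := Function.ne_iff.1 hw0
  have hmem (a : V) : a ∈ insert i (univ.filter fun j => G.Adj i j) ↔ a = i ∨ G.Adj i a := by
    simp
  have hcard : #(insert i (univ.filter fun j => G.Adj i j)) = d + 1 := by
    rw [card_insert_of_notMem (by simp), hsupp i hi]
  have hnbr {a b : V} (hab : G.Adj a b) (ha : G.Adj i a) : b = i ∨ G.Adj i b := by
    by_contra! h
    exact h.1 (hcomp i (hsupp i hi) b i h.2 G.irrefl (ha.reachable.trans hab.reachable).symm)
  have hsub {a b : V} (hab : G.Adj a b) : a = i ∨ G.Adj i a := by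
    by_cases ha : G.Adj i a
    · exact Or.inr ha
    by_cases hb : G.Adj i b
    · exact hnbr hab.symm hb
    · exact absurd (hcomp i (hsupp i hi) a b ha hb hab.reachable) hab.ne
  refine ⟨_, hcard, fun a b => ⟨fun hab => ⟨hab.ne, (hmem a).2 (hsub hab),
    (hmem b).2 (hsub hab.symm)⟩, fun ⟨hab, ha, hb⟩ => ?_⟩⟩
  have hwa : w a ≠ 0 := by
    rcases (hmem a).1 ha with rfl | h
    · exact hi
    · exact fun ha0 => hi (eq_zero_of_mulVec_alpha hw (hwμ a) h ha0)
  have h1 : (univ.filter fun j => G.Adj a j) ⊆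
      (insert i (univ.filter fun j => G.Adj i j)).erase a := fun j hj => by
    have haj := (mem_filter.1 hj).2
    exact mem_erase.2 ⟨haj.ne', (hmem j).2 (hsub haj.symm)⟩
  have h2 := eq_of_subset_of_card_le h1 (by rw [card_erase_of_mem ha, hcard, hsupp a hwa]; simp)
  have h3 : b ∈ univ.filter fun j => G.Adj a j := h2 ▸ mem_erase.2 ⟨hab.symm, hb⟩
  exact (mem_filter.1 h3).2

end Extremal

theorem stmt2 (α : ℝ) (hα : 0 ≤ α) (n β : ℕ) (G : SimpleGraph (Fin n))
    (hβ : matchingNumber G = β)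
    (h2 : (n : ℝ) = ((2 * α + 3) * β + α + 2) / (α + 1)) :
    alphaRadius α G ≤ 2 * (α + 1) * β ∧
      (alphaRadius α G = 2 * (α + 1) * β ↔
        (Nonempty (G ≃g graphJoin (⊤ : SimpleGraph (Fin β))
            (⊥ : SimpleGraph (Fin (n - β)))) ∨
          Nonempty (G ≃g graphSum (⊤ : SimpleGraph (Fin (2 * β + 1)))
            (⊥ : SimpleGraph (Fin (n - (2 * β + 1))))))) := by
  have hα1 : 0 < α + 1 := by linarith
  have hcard : (α + 1) * Fintype.card (Fin n) = (2 * α + 3) * β + α + 2 := by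
    rw [Fintype.card_fin, h2]
    field_simp
  have hn : 2 * β + 2 ≤ n := by
    have h : (2 * β + 1 : ℝ) < n := by
      rw [h2, lt_div_iff₀ hα1]
      nlinarith [(Nat.cast_nonneg β : (0 : ℝ) ≤ β)]
    have h' : 2 * β + 1 < n := by exact_mod_cast h
    omega
  obtain ⟨S, hS, hdeg, hcomp⟩ := exists_barrier (G := G) (k := n - (2 * β + 2))
    (by rw [Fintype.card_fin, hβ]; omega)
  rw [hβ] at hS hdeg hcomp
  have hbound {t : ℝ} {v : Fin n → ℝ} (hv : v ≠ 0)
      (hvt : (α • degMat G + adjMat G).mulVec v = t • v) :=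
    eigenvalue_le_of_mulVec_le (isSymm_alpha α G) (alpha_nonneg hα G) (testVector_pos hα S)
      (mulVec_testVector_le hα hS hdeg hcard) hv hvt
  rw [nonempty_iso_graphJoin_iff, nonempty_iso_graphSum_iff]
  refine ⟨Real.sSup_le (fun t ⟨v, hv, hvt⟩ => (hbound hv hvt).1) (by positivity), ?_, ?_⟩
  · intro heq
    obtain rfl | hβpos := Nat.eq_zero_or_pos β
    · refine Or.inl ⟨S, by omega, fun i j => ?_⟩
      obtain rfl : S = ∅ := card_eq_zero.1 (by omega)
      have h0 : #{j | G.Adj i j ∧ j ∉ (∅ : Finset (Fin n))} = 0 := by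
        simpa using hdeg i (notMem_empty i)
      have hij := filter_eq_empty_iff.1 (card_eq_zero.1 h0) (mem_univ j)
      simpa using hij
    · obtain ⟨v, hv, hvt⟩ := specRad_mem (M := α • degMat G + adjMat G)
        (heq.symm ▸ by positivity : 0 < alphaRadius α G)
      obtain ⟨w, hw, hw0, hwμ, hsupp⟩ := (hbound hv hvt).2 heq
      obtain rfl | hSne := S.eq_empty_or_nonempty
      · refine Or.inr (adj_iff_of_eigenvector_of_regular (hcomp rfl) hw hw0 hwμ fun i hi => ?_)
        simpa using ((mulVec_testVector_of_notMem hα (notMem_empty i)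
          (hdeg i (notMem_empty i))).2.1 (hsupp i hi)).2
      · exact Or.inl ⟨S, adj_iff_of_eigenvector_of_nonempty hα hS hSne hdeg hcard hw hw0 hwμ hsupp⟩
  · have hmax (t : ℝ) (v : Fin n → ℝ) (hv : v ≠ 0)
        (hvt : (α • degMat G + adjMat G).mulVec v = t • v) := (hbound hv hvt).1
    rintro (⟨T, hT, hG⟩ | ⟨T, hT, hG⟩)
    · refine specRad_eq_of_mulVec_eq hmax (fun h => ?_) (mulVec_testVector_of_join hα hT hcard hG)
      exact (testVector_pos hα T ⟨0, by omega⟩).ne' (congrFun h _)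
    · refine specRad_eq_of_mulVec_eq hmax (fun h => ?_) (mulVec_indicator_of_clique hT hG)
      obtain ⟨i, hi⟩ : T.Nonempty := card_pos.1 (by omega)
      simpa [hi] using congrFun h i
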